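/- There exist constants c, C > 0 such that for all even N ≥ 2 the following holds. Let G be the hypercube {0,1}^N with x ∼ y iff x and y differ in exactly one coordinate, let the lamplighter perform simple random walk (p(x,y) = 1/N for y ∼ x), let ν be the uniform measure on {0,1}^N, let μ be the uniform measure on {0,1}^{{0,1}^N}, and let c_x(σ) = 1/2 for all x, σ. Then the logarithmic Sobolev constant of the lamplighter graph satisfies c·N·2^N ≤ C_LS(π) ≤ C·N·2^N. -/

import Mathlib

open Finset

/-- Flip the lamp at site `x`: `σ^x`. -/
def flipAt {V : Type*} [DecidableEq V] (σ : V → Bool) (x : V) : V → Bool :=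
  Function.update σ x (!σ x)

/-- Entropy of `h` with respect to the measure `m`:
`Ent_m(h) = Σ m·h·log(h / Σ m·h)` (the convention `0·log 0 = 0` is automatic
since `Real.log 0 = 0`). -/
noncomputable def Ent {α : Type*} [Fintype α] (m h : α → ℝ) : ℝ :=
  ∑ a, m a * h a * Real.log (h a / ∑ b, m b * h b)

/-- Variance of `g` with respect to the probability measure `m`. -/
noncomputable def Var {α : Type*} [Fintype α] (m g : α → ℝ) : ℝ :=
  ∑ a, m a * g a ^ 2 - (∑ a, m a * g a) ^ 2

/-- Base Dirichlet form `E_ν(g) = (1/2) Σ_x Σ_{y∼x} ν(x) p(x,y) (g(y)-g(x))²`. -/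
noncomputable def Enu {V : Type*} [Fintype V] (G : SimpleGraph V) [DecidableRel G.Adj]
    (p : V → V → ℝ) (ν : V → ℝ) (g : V → ℝ) : ℝ :=
  (1 / 2) * ∑ x, ∑ y ∈ G.neighborFinset x, ν x * p x y * (g y - g x) ^ 2

/-- Lamp Dirichlet form `E_μ(h) = (1/2) Σ_σ Σ_x μ(σ) c_x(σ) (h(σ^x)-h(σ))²`. -/
noncomputable def Emu {V : Type*} [Fintype V] [DecidableEq V]
    (μ : (V → Bool) → ℝ) (c : V → (V → Bool) → ℝ) (h : (V → Bool) → ℝ) : ℝ :=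
  (1 / 2) * ∑ σ : V → Bool, ∑ x : V, μ σ * c x σ * (h (flipAt σ x) - h σ) ^ 2

/-- Wreath-product Dirichlet form
`E_π(f) = (1/4) Σ_σ Σ_x π(σ,x) [Σ_{y∼x} p(x,y)(f(σ,y)-f(σ,x))² + c_x(σ)(f(σ^x,x)-f(σ,x))²]`
where `π = μ ⊗ ν`. -/
noncomputable def Epi {V : Type*} [Fintype V] [DecidableEq V]
    (G : SimpleGraph V) [DecidableRel G.Adj]
    (p : V → V → ℝ) (ν : V → ℝ) (μ : (V → Bool) → ℝ) (c : V → (V → Bool) → ℝ)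
    (f : (V → Bool) → V → ℝ) : ℝ :=
  (1 / 4) * ∑ σ : V → Bool, ∑ x : V, (μ σ * ν x) *
    ((∑ y ∈ G.neighborFinset x, p x y * (f σ y - f σ x) ^ 2)
      + c x σ * (f (flipAt σ x) x - f σ x) ^ 2)

/-- Entropy of `f²` on the wreath product with respect to `π = μ ⊗ ν`. -/
noncomputable def EntPi {V : Type*} [Fintype V] [DecidableEq V]
    (μ : (V → Bool) → ℝ) (ν : V → ℝ) (f : (V → Bool) → V → ℝ) : ℝ :=
  Ent (fun q : (V → Bool) × V => μ q.1 * ν q.2) (fun q => f q.1 q.2 ^ 2)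

/-- Closure of a set of vertices: `B̄ = {x ∈ V : ∃ y ∈ B, x ∼ y}`. -/
def closureSet {V : Type*} [Fintype V] (G : SimpleGraph V) [DecidableRel G.Adj]
    (B : Finset V) : Finset V :=
  Finset.univ.filter (fun x => ∃ y ∈ B, G.Adj x y)

lemma Ent_equiv {α β : Type*} [Fintype α] [Fintype β] (e : β ≃ α) (m h : α → ℝ) :
    Ent m h = Ent (fun b => m (e b)) (fun b => h (e b)) := by
  unfold Ent
  rw [← e.sum_comp (fun b => m b * h b), ← e.sum_comp]

lemma Ent_prod {α β : Type*} [Fintype α] [Fintype β] (m₁ : α → ℝ) (m₂ : β → ℝ)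
    (h : α → β → ℝ) (h1 : ∀ a, 0 < m₁ a) (h2 : ∀ b, 0 < m₂ b) (hh : ∀ a b, 0 ≤ h a b) :
    Ent (fun q : α × β => m₁ q.1 * m₂ q.2) (fun q => h q.1 q.2) =
      ∑ a, m₁ a * Ent m₂ (h a) + Ent m₁ (fun a => ∑ b, m₂ b * h a b) := by
  have hT : ∑ q : α × β, m₁ q.1 * m₂ q.2 * h q.1 q.2 = ∑ a, m₁ a * ∑ b, m₂ b * h a b := by
    rw [Fintype.sum_prod_type]
    refine Finset.sum_congr rfl fun a _ => ?_
    rw [Finset.mul_sum]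
    exact Finset.sum_congr rfl fun b _ => by ring
  unfold Ent
  rw [hT, Fintype.sum_prod_type, ← Finset.sum_add_distrib]
  refine Finset.sum_congr rfl fun a _ => ?_
  rw [mul_assoc, ← mul_add, Finset.sum_mul, ← Finset.sum_add_distrib, Finset.mul_sum]
  refine Finset.sum_congr rfl fun b _ => ?_
  dsimp only
  rcases (hh a b).eq_or_lt with h0 | h0
  · simp [← h0]
  · have hnn : ∀ a, 0 ≤ ∑ b, m₂ b * h a b := fun a =>
      Finset.sum_nonneg fun b _ => mul_nonneg (h2 b).le (hh a b)
    have hS : 0 < ∑ b, m₂ b * h a b :=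
      Finset.sum_pos' (fun b _ => mul_nonneg (h2 b).le (hh a b))
        ⟨b, Finset.mem_univ _, mul_pos (h2 b) h0⟩
    have hTT : 0 < ∑ a, m₁ a * ∑ b, m₂ b * h a b :=
      Finset.sum_pos' (fun a _ => mul_nonneg (h1 a).le (hnn a))
        ⟨a, Finset.mem_univ _, mul_pos (h1 a) hS⟩
    rw [Real.log_div h0.ne' hTT.ne', Real.log_div h0.ne' hS.ne', Real.log_div hS.ne' hTT.ne']
    ring

/-- reverse triangle inequality in weighted `L²`. -/
lemma sqrt_diff_sq {β : Type*} [Fintype β] (m u v : β → ℝ) (hm : ∀ b, 0 ≤ m b) :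
    (√(∑ b, m b * u b ^ 2) - √(∑ b, m b * v b ^ 2)) ^ 2 ≤ ∑ b, m b * (u b - v b) ^ 2 := by
  have hu : 0 ≤ ∑ b, m b * u b ^ 2 := Finset.sum_nonneg fun b _ => mul_nonneg (hm b) (sq_nonneg _)
  have hv : 0 ≤ ∑ b, m b * v b ^ 2 := Finset.sum_nonneg fun b _ => mul_nonneg (hm b) (sq_nonneg _)
  have hcs : ∑ b, m b * (u b * v b) ≤ √(∑ b, m b * u b ^ 2) * √(∑ b, m b * v b ^ 2) := by
    rw [← Real.sqrt_mul hu]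
    apply Real.le_sqrt_of_sq_le
    have := Finset.sum_mul_sq_le_sq_mul_sq Finset.univ (fun b => √(m b) * u b)
      (fun b => √(m b) * v b)
    have e1 : ∀ b, √(m b) * u b * (√(m b) * v b) = m b * (u b * v b) := fun b => by
      rw [mul_mul_mul_comm, Real.mul_self_sqrt (hm b)]
    have e2 : ∀ b, ∀ w : β → ℝ, (√(m b) * w b) ^ 2 = m b * (w b) ^ 2 := fun b w => by
      rw [mul_pow, Real.sq_sqrt (hm b)]
    simpa only [e1, e2] using this
  have hx : ∑ b, m b * (u b - v b) ^ 2 =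
      ∑ b, m b * u b ^ 2 + ∑ b, m b * v b ^ 2 - 2 * ∑ b, m b * (u b * v b) := by
    rw [Finset.mul_sum, ← Finset.sum_add_distrib, ← Finset.sum_sub_distrib]
    exact Finset.sum_congr rfl fun b _ => by ring
  rw [hx, sub_sq, Real.sq_sqrt hu, Real.sq_sqrt hv]
  linarith

/-- `E(|F| - ‖F‖)² ≤ Ent(F²)`. -/
lemma sq_dev_le_Ent {β : Type*} [Fintype β] (m F : β → ℝ) (hm : ∀ b, 0 < m b)
    (hs : ∑ b, m b = 1) :
    ∑ b, m b * (√(∑ b, m b * F b ^ 2) - |F b|) ^ 2 ≤ Ent m (fun b => F b ^ 2) := by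
  have hu : 0 ≤ ∑ b, m b * F b ^ 2 :=
    Finset.sum_nonneg fun b _ => mul_nonneg (hm b).le (sq_nonneg _)
  unfold Ent
  set T := ∑ b, m b * F b ^ 2 with hT
  have hL : ∑ b, m b * (√T - |F b|) ^ 2 = ∑ b, m b * (2 * F b ^ 2 - 2 * √T * |F b|) := by
    have : ∀ b, m b * (√T - |F b|) ^ 2 =
        m b * (2 * F b ^ 2 - 2 * √T * |F b|) + (m b * T - m b * F b ^ 2) := fun b => by
      rw [sub_sq, Real.sq_sqrt hu, sq_abs]; ring
    rw [Finset.sum_congr rfl fun b _ => this b, Finset.sum_add_distrib, Finset.sum_sub_distrib,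
      ← Finset.sum_mul, hs, ← hT]
    ring
  rw [hL]
  refine Finset.sum_le_sum fun b _ => ?_
  rw [mul_assoc (m b)]
  refine mul_le_mul_of_nonneg_left ?_ (hm b).le
  by_cases h0 : F b = 0
  · simp [h0]
  have hF : 0 < |F b| := abs_pos.mpr h0
  have hTp : 0 < T := Finset.sum_pos' (fun b _ => mul_nonneg (hm b).le (sq_nonneg _))
    ⟨b, Finset.mem_univ _, mul_pos (hm b) (by positivity)⟩
  have hsT : 0 < √T := Real.sqrt_pos.mpr hTp
  have hlog : Real.log (F b ^ 2 / T) = - 2 * Real.log (√T / |F b|) := by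
    have : F b ^ 2 / T = ((√T / |F b|) ^ 2)⁻¹ := by
      rw [div_pow, Real.sq_sqrt hu, sq_abs, inv_div]
    rw [this, Real.log_inv, Real.log_pow]; push_cast; ring
  have h1 := Real.log_le_sub_one_of_pos (div_pos hsT hF)
  rw [hlog]
  have h2 : F b ^ 2 * (√T / |F b|) = √T * |F b| := by
    rw [← sq_abs]; field_simp
  nlinarith [sq_nonneg (F b), mul_le_mul_of_nonneg_left h1 (sq_nonneg (F b))]

lemma two_point (g : Bool → ℝ) :
    Ent (fun _ : Bool => (1 / 2 : ℝ)) (fun b => g b ^ 2) ≤ (g true - g false) ^ 2 := by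
  unfold Ent
  rw [Fintype.sum_bool, Fintype.sum_bool]
  set u := g true
  set v := g false
  set T := 1 / 2 * u ^ 2 + 1 / 2 * v ^ 2 with hT
  rcases (by positivity : 0 ≤ T).eq_or_lt with h0 | h0
  · rw [← h0]; simp; positivity
  have key : ∀ w : ℝ, 1 / 2 * w ^ 2 * Real.log (w ^ 2 / T) ≤ 1 / 2 * w ^ 2 * (w ^ 2 / T - 1) := by
    intro w
    by_cases hw : w = 0
    · simp [hw]
    · exact mul_le_mul_of_nonneg_left (Real.log_le_sub_one_of_pos (by positivity)) (by positivity)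
  have h3 : 1 / 2 * u ^ 2 * (u ^ 2 / T - 1) + 1 / 2 * v ^ 2 * (v ^ 2 / T - 1) ≤ (u - v) ^ 2 := by
    have : 1 / 2 * u ^ 2 * (u ^ 2 / T - 1) + 1 / 2 * v ^ 2 * (v ^ 2 / T - 1)
        = ((u - v) ^ 2 * (u + v) ^ 2 / 4) / T := by
      field_simp; rw [hT]; ring
    rw [this, div_le_iff₀ h0, hT]
    nlinarith [mul_nonneg (sq_nonneg (u - v)) (sq_nonneg (u - v))]
  linarith [key u, key v]

theorem cube_LS_aux (α : Type*) [Fintype α] : ∀ (_ : DecidableEq α) (f : (α → Bool) → ℝ),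
    Ent (fun _ : α → Bool => (1 / 2 ^ Fintype.card α : ℝ)) (fun x => f x ^ 2) ≤
      ∑ x : α → Bool, 1 / 2 ^ Fintype.card α * ∑ i, (f (flipAt x i) - f x) ^ 2 := by
  classical
  refine Fintype.induction_empty_option (P := fun α [Fintype α] =>
    ∀ (_ : DecidableEq α) (f : (α → Bool) → ℝ),
    Ent (fun _ : α → Bool => (1 / 2 ^ Fintype.card α : ℝ)) (fun x => f x ^ 2) ≤
      ∑ x : α → Bool, 1 / 2 ^ Fintype.card α * ∑ i, (f (flipAt x i) - f x) ^ 2) ?_ ?_ ?_ α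
  · intro α β _ e ih _ f
    let _ := Fintype.ofEquiv β e.symm
    let _ : DecidableEq α := Classical.decEq _
    have ih := ih inferInstance (fun x => f (fun b => x (e.symm b)))
    let E : (α → Bool) ≃ (β → Bool) := Equiv.arrowCongr e (Equiv.refl _)
    rw [Ent_equiv E, ← E.sum_comp]
    have hc : Fintype.card α = Fintype.card β := Fintype.card_congr e
    rw [← hc]
    refine ih.trans (le_of_eq ?_)
    refine Finset.sum_congr rfl fun x _ => ?_
    congr 1
    rw [← Equiv.sum_comp e (fun i => (f (flipAt (E x) i) - f (E x)) ^ 2)]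
    refine Finset.sum_congr rfl fun i _ => ?_
    have : flipAt (E x) (e i) = fun b => flipAt x i (e.symm b) := by
      funext b
      simp only [flipAt, Function.update_apply, E, Equiv.arrowCongr_apply]
      simp [Equiv.symm_apply_eq]
    rw [this]
    rfl
  · intro _ f
    simp only [Ent, Fintype.card_pempty, Fintype.sum_unique]
    simp
  · intro α _ ih _ f
    let e : Bool × (α → Bool) ≃ (Option α → Bool) :=
      (Equiv.piOptionEquivProd (β := fun _ : Option α => Bool)).symm
    let _ : DecidableEq α := Classical.decEq _
    have ih := ih inferInstance
    set M : ℝ := 1 / 2 ^ Fintype.card α with hM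
    have hMp : 0 < M := by positivity
    have hMM : (1 / 2 ^ Fintype.card (Option α) : ℝ) = 1 / 2 * M := by
      rw [Fintype.card_option, hM, pow_succ]; field_simp
    have hn : ∀ b x, flipAt (e (b, x)) none = e (!b, x) := by
      intro b x
      funext j
      rcases j with _ | j <;> simp [flipAt, e, Equiv.piOptionEquivProd]
    have hsm : ∀ b x i, flipAt (e (b, x)) (some i) = e (b, flipAt x i) := by
      intro b x i
      funext j
      rcases j with _ | j <;>
        simp [flipAt, e, Equiv.piOptionEquivProd, Function.update_apply]
    rw [hMM, Ent_equiv e, ← e.sum_comp, Fintype.sum_prod_type]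
    simp only [Fintype.sum_option, hn, hsm]
    have hp := Ent_prod (fun _ : Bool => (1 / 2 : ℝ)) (fun _ : α → Bool => M)
      (fun b x => f (e (b, x)) ^ 2) (fun _ => by norm_num) (fun _ => hMp)
      (fun _ _ => sq_nonneg _)
    simp only [Prod.mk.eta] at hp
    rw [hp]
    have h2 := two_point (fun b => √(∑ x, M * f (e (b, x)) ^ 2))
    have hsq : ∀ b, √(∑ x, M * f (e (b, x)) ^ 2) ^ 2 = ∑ x, M * f (e (b, x)) ^ 2 := fun b =>
      Real.sq_sqrt (Finset.sum_nonneg fun x _ => mul_nonneg hMp.le (sq_nonneg _))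
    simp only [hsq] at h2
    have h3 := sqrt_diff_sq (fun _ : α → Bool => M) (fun x => f (e (true, x)))
      (fun x => f (e (false, x))) (fun _ => hMp.le)
    have h4 := h2.trans h3
    have i1 := ih (fun x => f (e (true, x)))
    have i2 := ih (fun x => f (e (false, x)))
    rw [Fintype.sum_bool, Fintype.sum_bool]
    simp only [Bool.not_true, Bool.not_false]
    refine (add_le_add (add_le_add (mul_le_mul_of_nonneg_left i1 (by norm_num))
      (mul_le_mul_of_nonneg_left i2 (by norm_num))) h4).trans (le_of_eq ?_)
    rw [Finset.mul_sum, Finset.mul_sum, ← Finset.sum_add_distrib, ← Finset.sum_add_distrib,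
      ← Finset.sum_add_distrib]
    refine Finset.sum_congr rfl fun x _ => ?_
    ring

theorem cube_LS {α : Type*} [Fintype α] [DecidableEq α] (f : (α → Bool) → ℝ) :
    Ent (fun _ : α → Bool => (1 / 2 ^ Fintype.card α : ℝ)) (fun x => f x ^ 2) ≤
      ∑ x : α → Bool, 1 / 2 ^ Fintype.card α * ∑ i, (f (flipAt x i) - f x) ^ 2 :=
  cube_LS_aux α _ f

lemma flipAt_flipAt {α : Type*} [DecidableEq α] (x : α → Bool) (i : α) :
    flipAt (flipAt x i) i = x := by
  funext j
  by_cases h : j = i <;> simp [flipAt, Function.update_apply, h]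

/-- The flip at a site, as a permutation of the configurations. -/
def flipEquiv {α : Type*} [DecidableEq α] (i : α) : (α → Bool) ≃ (α → Bool) where
  toFun x := flipAt x i
  invFun x := flipAt x i
  left_inv x := flipAt_flipAt x i
  right_inv x := flipAt_flipAt x i

lemma sum_flipAt {α : Type*} [Fintype α] [DecidableEq α] (i : α) (φ : (α → Bool) → ℝ) :
    ∑ x, φ (flipAt x i) = ∑ x, φ x := (flipEquiv i).sum_comp φ

lemma nbr_sum (N : ℕ) (G : SimpleGraph (Fin N → Bool)) [DecidableRel G.Adj]
    (hG : ∀ x y : Fin N → Bool, G.Adj x y ↔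
        ∃ i : Fin N, x i ≠ y i ∧ ∀ j : Fin N, j ≠ i → x j = y j)
    (p : (Fin N → Bool) → (Fin N → Bool) → ℝ)
    (hp : ∀ x y, G.Adj x y → p x y = 1 / (N : ℝ)) (x : Fin N → Bool) (φ : (Fin N → Bool) → ℝ) :
    ∑ y ∈ G.neighborFinset x, p x y * φ y = 1 / (N : ℝ) * ∑ i, φ (flipAt x i) := by
  have hinj : Function.Injective (flipAt x) := by
    intro i j hij
    by_contra hne
    have := congrFun hij i
    simp [flipAt, Function.update_apply, hne] at this
  have himg : G.neighborFinset x = Finset.univ.image (flipAt x) := by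
    ext y
    simp only [SimpleGraph.mem_neighborFinset, hG, Finset.mem_image, Finset.mem_univ, true_and]
    refine exists_congr fun i => ?_
    constructor
    · rintro ⟨h1, h2⟩
      funext j
      by_cases hj : j = i
      · subst hj
        simp only [flipAt, Function.update_self]
        revert h1
        cases x j <;> cases y j <;> simp
      · simp [flipAt, Function.update_apply, hj, h2 j hj]
    · rintro rfl
      refine ⟨by simp [flipAt], fun j hj => by simp [flipAt, Function.update_apply, hj]⟩
  have h1 : ∑ y ∈ G.neighborFinset x, p x y * φ y
      = ∑ y ∈ G.neighborFinset x, 1 / (N : ℝ) * φ y := by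
    refine Finset.sum_congr rfl fun y hy => ?_
    rw [hp x y (by simpa using hy)]
  rw [h1, himg, Finset.sum_image (fun a _ b _ h => hinj h), Finset.mul_sum]

lemma upper_bound (N : ℕ) (hN : 2 ≤ N) (f : ((Fin N → Bool) → Bool) → (Fin N → Bool) → ℝ) :
    EntPi (fun _ => 1 / 2 ^ 2 ^ N) (fun _ => 1 / 2 ^ N) f ≤
      7 * N * 2 ^ N * ∑ σ : (Fin N → Bool) → Bool, ∑ x : Fin N → Bool,
        (1 / 2 ^ 2 ^ N * (1 / 2 ^ N)) * ((1 / (N : ℝ) * ∑ i, (f σ (flipAt x i) - f σ x) ^ 2)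
          + 1 / 2 * (f (flipAt σ x) x - f σ x) ^ 2) := by
  set ν : ℝ := 1 / 2 ^ N with hν
  set μ : ℝ := 1 / 2 ^ 2 ^ N with hμ
  have hνp : 0 < ν := by positivity
  have hμp : 0 < μ := by positivity
  have hnν : (2 : ℝ) ^ N * ν = 1 := by rw [hν]; field_simp
  have hNp : (2 : ℝ) ≤ N := by exact_mod_cast hN
  have hn1 : (1 : ℝ) ≤ 2 ^ N := one_le_pow₀ (by norm_num)
  generalize hn : (2 : ℝ) ^ N = n at *
  -- the pieces
  let D : ((Fin N → Bool) → Bool) → ℝ := fun σ =>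
    ∑ x : Fin N → Bool, ν * ∑ i, (f σ (flipAt x i) - f σ x) ^ 2
  let L : ((Fin N → Bool) → Bool) → ℝ := fun σ =>
    ∑ x : Fin N → Bool, ν * (f (flipAt σ x) x - f σ x) ^ 2
  let g : ((Fin N → Bool) → Bool) → ℝ := fun σ => √(∑ x, ν * f σ x ^ 2)
  have hD0 : ∀ σ, 0 ≤ D σ := fun σ => by positivity
  have hL0 : ∀ σ, 0 ≤ L σ := fun σ => by positivity
  have hE : ∑ σ : (Fin N → Bool) → Bool, ∑ x : Fin N → Bool,
        (μ * ν) * ((1 / (N : ℝ) * ∑ i, (f σ (flipAt x i) - f σ x) ^ 2)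
          + 1 / 2 * (f (flipAt σ x) x - f σ x) ^ 2) =
      1 / (N : ℝ) * ∑ σ, μ * D σ + 1 / 2 * ∑ σ, μ * L σ := by
    simp only [D, L]
    rw [Finset.mul_sum, Finset.mul_sum, ← Finset.sum_add_distrib]
    refine Finset.sum_congr rfl fun σ _ => ?_
    rw [← mul_assoc, ← mul_assoc, Finset.mul_sum, Finset.mul_sum, ← Finset.sum_add_distrib]
    refine Finset.sum_congr rfl fun x _ => ?_
    ring
  have hEntν : ∀ σ, Ent (fun _ : Fin N → Bool => ν) (fun x => f σ x ^ 2) ≤ D σ := by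
    intro σ
    have := cube_LS (f σ)
    simpa only [Fintype.card_fin, ← hν, hn] using this
  have hsν : ∑ _x : Fin N → Bool, ν = 1 := by
    rw [Finset.sum_const, Finset.card_univ, Fintype.card_fun, Fintype.card_bool, Fintype.card_fin,
      nsmul_eq_mul]
    push_cast
    rw [hn, hnν]
  have hdev : ∀ σ, ∑ y, (g σ - |f σ y|) ^ 2 ≤ n * D σ := by
    intro σ
    have h := (sq_dev_le_Ent (fun _ => ν) (f σ) (fun _ => hνp) hsν).trans (hEntν σ)
    rw [← Finset.mul_sum] at h
    calc ∑ y, (g σ - |f σ y|) ^ 2 = n * (ν * ∑ y, (g σ - |f σ y|) ^ 2) := by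
          rw [← mul_assoc, hnν, one_mul]
      _ ≤ n * D σ := mul_le_mul_of_nonneg_left h (by linarith)
  have hEntμ : Ent (fun _ : (Fin N → Bool) → Bool => μ) (fun σ => g σ ^ 2) ≤
      ∑ σ, μ * ∑ y, (g (flipAt σ y) - g σ) ^ 2 := by
    have := cube_LS g
    rw [Fintype.card_fun, Fintype.card_bool, Fintype.card_fin] at this
    exact this
  have hg2 : ∀ σ, g σ ^ 2 = ∑ x, ν * f σ x ^ 2 := fun σ =>
    Real.sq_sqrt (Finset.sum_nonneg fun x _ => mul_nonneg hνp.le (sq_nonneg _))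
  have hpt : ∀ σ y, (g (flipAt σ y) - g σ) ^ 2 ≤ 3 * ((g (flipAt σ y) - |f (flipAt σ y) y|) ^ 2
      + (f (flipAt σ y) y - f σ y) ^ 2 + (g σ - |f σ y|) ^ 2) := by
    intro σ y
    have h1 : (|f (flipAt σ y) y| - |f σ y|) ^ 2 ≤ (f (flipAt σ y) y - f σ y) ^ 2 := by
      rw [sq_le_sq]; exact abs_abs_sub_abs_le _ _
    generalize g (flipAt σ y) = A at *
    generalize g σ = B at *
    generalize |f (flipAt σ y) y| = a at *
    generalize |f σ y| = b at *
    nlinarith [sq_nonneg ((A - a) - (a - b)), sq_nonneg ((A - a) - (b - B)),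
      sq_nonneg ((a - b) - (b - B))]
  have hswap : ∑ σ, μ * ∑ y, (g (flipAt σ y) - |f (flipAt σ y) y|) ^ 2 =
      ∑ σ, μ * ∑ y, (g σ - |f σ y|) ^ 2 := by
    rw [← Finset.mul_sum, ← Finset.mul_sum, Finset.sum_comm]
    congr 1
    rw [Finset.sum_comm (f := fun σ y => (g σ - |f σ y|) ^ 2)]
    exact Finset.sum_congr rfl fun y _ => sum_flipAt y (fun σ => (g σ - |f σ y|) ^ 2)
  have hL : ∀ σ, ∑ y, (f (flipAt σ y) y - f σ y) ^ 2 = n * L σ := by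
    intro σ
    simp only [L]
    rw [← Finset.mul_sum, ← mul_assoc, hnν, one_mul]
  have hdevsum : ∑ σ, μ * ∑ y, (g σ - |f σ y|) ^ 2 ≤ n * ∑ σ, μ * D σ := by
    rw [Finset.mul_sum]
    refine Finset.sum_le_sum fun σ _ => ?_
    nlinarith [mul_le_mul_of_nonneg_left (hdev σ) hμp.le]
  have hLsum : ∑ σ, μ * ∑ y, (f (flipAt σ y) y - f σ y) ^ 2 = n * ∑ σ, μ * L σ := by
    rw [Finset.mul_sum]
    refine Finset.sum_congr rfl fun σ _ => ?_
    rw [hL]; ring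
  have hbig : ∑ σ, μ * ∑ y, (g (flipAt σ y) - g σ) ^ 2 ≤
      3 * (∑ σ, μ * ∑ y, (g (flipAt σ y) - |f (flipAt σ y) y|) ^ 2 +
        ∑ σ, μ * ∑ y, (f (flipAt σ y) y - f σ y) ^ 2 + ∑ σ, μ * ∑ y, (g σ - |f σ y|) ^ 2) := by
    rw [← Finset.sum_add_distrib, ← Finset.sum_add_distrib, Finset.mul_sum]
    refine Finset.sum_le_sum fun σ _ => ?_
    rw [← mul_add, ← mul_add, ← Finset.sum_add_distrib, ← Finset.sum_add_distrib,
      mul_left_comm, Finset.mul_sum (a := (3 : ℝ))]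
    exact mul_le_mul_of_nonneg_left (Finset.sum_le_sum fun y _ => hpt σ y) hμp.le
  have hprod := Ent_prod (fun _ : (Fin N → Bool) → Bool => μ) (fun _ : Fin N → Bool => ν)
    (fun σ x => f σ x ^ 2) (fun _ => hμp) (fun _ => hνp) (fun _ _ => sq_nonneg _)
  simp only [hg2] at hEntμ
  have hfirst : ∑ σ, μ * Ent (fun _ : Fin N → Bool => ν) (fun x => f σ x ^ 2) ≤ ∑ σ, μ * D σ :=
    Finset.sum_le_sum fun σ _ => mul_le_mul_of_nonneg_left (hEntν σ) hμp.le
  unfold EntPi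
  rw [hprod, hE]
  have hDs : 0 ≤ ∑ σ, μ * D σ := Finset.sum_nonneg fun σ _ => mul_nonneg hμp.le (hD0 σ)
  have hLs : 0 ≤ ∑ σ, μ * L σ := Finset.sum_nonneg fun σ _ => mul_nonneg hμp.le (hL0 σ)
  generalize ∑ σ, μ * D σ = DD at *
  generalize ∑ σ, μ * L σ = LL at *
  rw [hswap, hLsum] at hbig
  have hfin : 7 * (N : ℝ) * n * (1 / (N : ℝ) * DD + 1 / 2 * LL)
      = 7 * n * DD + 7 / 2 * N * (n * LL) := by
    field_simp
  rw [hfin]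
  have hnL : 0 ≤ n * LL := mul_nonneg (by linarith) hLs
  nlinarith [mul_le_mul_of_nonneg_right hNp hnL, mul_le_mul_of_nonneg_right hn1 hDs]

lemma Ent_indicator {α : Type*} [Fintype α] (m h : α → ℝ) (hh : ∀ a, h a = 0 ∨ h a = 1) :
    Ent m h = (∑ a, m a * h a) * (- Real.log (∑ a, m a * h a)) := by
  unfold Ent
  rw [Finset.sum_mul (f := fun a => m a * h a)]
  refine Finset.sum_congr rfl fun a _ => ?_
  rcases hh a with h0 | h0 <;> simp [h0]

lemma card_lamps (N : ℕ) (i₀ : Fin N) :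
    (Finset.univ.filter fun σ : (Fin N → Bool) → Bool =>
      ∀ y, y i₀ = true → σ y = false).card = 2 ^ 2 ^ (N - 1) := by
  classical
  have h1 : (Finset.univ.filter fun y : Fin N → Bool => y i₀ = false).card = 2 ^ (N - 1) := by
    have : (Finset.univ.filter fun y : Fin N → Bool => y i₀ = false) =
        Fintype.piFinset (fun i => if i = i₀ then {false} else (Finset.univ : Finset Bool)) := by
      ext y
      simp only [Finset.mem_filter, Finset.mem_univ, true_and, Fintype.mem_piFinset]
      constructor
      · intro h i
        by_cases hi : i = i₀
        · simp [hi, h]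
        · simp [hi]
      · intro h
        simpa using h i₀
    rw [this, Fintype.card_piFinset]
    have : ∀ i, (if i = i₀ then ({false} : Finset Bool) else Finset.univ).card
        = if i = i₀ then 1 else 2 := fun i => by split_ifs <;> simp
    simp only [this]
    rw [Finset.prod_ite]
    simp [Finset.filter_ne']
  have : (Finset.univ.filter fun σ : (Fin N → Bool) → Bool => ∀ y, y i₀ = true → σ y = false) =
      Fintype.piFinset (fun y : Fin N → Bool =>
        if y i₀ = false then (Finset.univ : Finset Bool) else {false}) := by
    ext σ
    simp only [Finset.mem_filter, Finset.mem_univ, true_and, Fintype.mem_piFinset]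
    refine forall_congr' fun y => ?_
    by_cases hy : y i₀ = false <;> simp [hy]
  rw [this, Fintype.card_piFinset]
  have : ∀ y : Fin N → Bool, (if y i₀ = false then (Finset.univ : Finset Bool) else {false}).card
      = if y i₀ = false then 2 else 1 := fun i => by split_ifs <;> simp
  simp only [this]
  rw [Finset.prod_ite]
  simp [h1]

/-- The test function for the lower bound. -/
noncomputable def testF (N : ℕ) (i₀ : Fin N) (σ : (Fin N → Bool) → Bool) (x : Fin N → Bool) : ℝ :=
  if x i₀ = false ∧ ∀ y, y i₀ = true → σ y = false then 1 else 0

lemma lower_bound (N : ℕ) (hN : 2 ≤ N) : ∃ f : ((Fin N → Bool) → Bool) → (Fin N → Bool) → ℝ,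
    ∃ P : ℝ, 0 < P ∧
    P * (2 ^ (N - 1) * Real.log 2) ≤ EntPi (fun _ => 1 / 2 ^ 2 ^ N) (fun _ => 1 / 2 ^ N) f ∧
    ∑ σ : (Fin N → Bool) → Bool, ∑ x : Fin N → Bool,
        (1 / 2 ^ 2 ^ N * (1 / 2 ^ N)) * ((1 / (N : ℝ) * ∑ i, (f σ (flipAt x i) - f σ x) ^ 2)
          + 1 / 2 * (f (flipAt σ x) x - f σ x) ^ 2) = 2 * P / N := by
  let i₀ : Fin N := ⟨0, by omega⟩
  have h01 : ∀ σ x, testF N i₀ σ x ^ 2 = 0 ∨ testF N i₀ σ x ^ 2 = 1 := fun σ x => by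
    unfold testF; split_ifs <;> simp
  have hνs : ∑ _x : Fin N → Bool, (1 / 2 ^ N : ℝ) = 1 := by
    rw [Finset.sum_const, Finset.card_univ, Fintype.card_fun, Fintype.card_bool, Fintype.card_fin,
      nsmul_eq_mul]
    push_cast
    field_simp
  set ν : ℝ := 1 / 2 ^ N with hν
  set μ : ℝ := 1 / 2 ^ 2 ^ N with hμ
  have hνp : 0 < ν := by positivity
  have hμp : 0 < μ := by positivity
  let P : ℝ := ∑ q : ((Fin N → Bool) → Bool) × (Fin N → Bool), μ * ν * testF N i₀ q.1 q.2 ^ 2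
  have hP : P = ∑ σ, ∑ x, μ * ν * testF N i₀ σ x ^ 2 := Fintype.sum_prod_type _
  have hP0 : 0 < P := by
    refine Finset.sum_pos' (fun q _ => by positivity)
      ⟨(fun _ => false, fun _ => false), Finset.mem_univ _, ?_⟩
    simp only [testF]
    simp [hμp, hνp]
  have hPle : P ≤ 1 / 2 ^ 2 ^ (N - 1) := by
    have hle : P ≤ ∑ σ : (Fin N → Bool) → Bool,
        if (∀ y, y i₀ = true → σ y = false) then μ else 0 := by
      rw [hP]
      refine Finset.sum_le_sum fun σ _ => ?_
      split_ifs with h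
      · calc ∑ x, μ * ν * testF N i₀ σ x ^ 2 ≤ ∑ _x : Fin N → Bool, μ * ν := by
              refine Finset.sum_le_sum fun x _ => ?_
              rcases h01 σ x with h | h <;> rw [h]
              · simp; positivity
              · simp
          _ = μ := by rw [← Finset.mul_sum, hνs, mul_one]
      · refine le_of_eq (Finset.sum_eq_zero fun x _ => ?_)
        simp [testF, h]
    refine hle.trans (le_of_eq ?_)
    rw [← Finset.sum_filter, Finset.sum_const, card_lamps, nsmul_eq_mul, hμ]
    have : 2 ^ N = 2 ^ (N - 1) + 2 ^ (N - 1) := by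
      obtain ⟨k, rfl⟩ : ∃ k, N = k + 1 := ⟨N - 1, by omega⟩
      simp [pow_succ]; ring
    rw [this, pow_add]
    push_cast
    field_simp
  refine ⟨testF N i₀, P, hP0, ?_, ?_⟩
  · unfold EntPi
    rw [Ent_indicator _ _ (fun q => h01 q.1 q.2)]
    change _ ≤ P * (- Real.log P)
    refine mul_le_mul_of_nonneg_left ?_ hP0.le
    have := Real.log_le_log hP0 hPle
    rw [one_div, Real.log_inv, Real.log_pow] at this
    push_cast at this
    linarith
  · have hlamp : ∀ σ x, testF N i₀ (flipAt σ x) x = testF N i₀ σ x := by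
      intro σ x
      by_cases hx : x i₀ = false
      · have : ∀ y : Fin N → Bool, y i₀ = true → flipAt σ x y = σ y := by
          intro y hy
          have : y ≠ x := by rintro rfl; simp [hx] at hy
          simp [flipAt, Function.update_apply, this]
        unfold testF
        congr 1
        rw [eq_iff_iff]
        refine and_congr_right fun _ => forall_congr' fun y => forall_congr' fun hy => ?_
        rw [this y hy]
      · simp [testF, hx]
    have hwalk : ∀ σ x, ∑ i, (testF N i₀ σ (flipAt x i) - testF N i₀ σ x) ^ 2 =
        testF N i₀ σ (flipAt x i₀) ^ 2 + testF N i₀ σ x ^ 2 := by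
      intro σ x
      rw [Finset.sum_eq_single i₀]
      · have : testF N i₀ σ (flipAt x i₀) * testF N i₀ σ x = 0 := by
          by_cases hx : x i₀ = false <;> simp [testF, flipAt, hx]
        linear_combination -2 * this
      · intro i _ hi
        have : flipAt x i i₀ = x i₀ := by simp [flipAt, Function.update_apply, hi.symm]
        simp [testF, this]
      · simp
    have hs : ∀ σ, ∑ x, testF N i₀ σ (flipAt x i₀) ^ 2 = ∑ x, testF N i₀ σ x ^ 2 := fun σ =>
      sum_flipAt i₀ (fun x => testF N i₀ σ x ^ 2)
    simp only [hwalk, hlamp]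
    rw [hP, mul_div_right_comm, Finset.mul_sum]
    refine Finset.sum_congr rfl fun σ _ => ?_
    rw [← Finset.mul_sum, ← Finset.mul_sum]
    simp only [sub_self, ne_eq, OfNat.ofNat_ne_zero, not_false_eq_true, zero_pow, mul_zero,
      add_zero]
    rw [← Finset.mul_sum, Finset.sum_add_distrib, hs]
    ring

/-- for the lamplighter on the hypercube `{0,1}^N` (`N` even,
simple random walk `p(x,y) = 1/N` for `y ∼ x`, `ν` uniform on `{0,1}^N`,
`μ` uniform on `{0,1}^{{0,1}^N}`, `c_x(σ) = 1/2`), there exist universal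
constants `c₀, C₀ > 0` such that `c₀ N 2^N ≤ C_LS(π) ≤ C₀ N 2^N`. -/
theorem hypercube_lamplighter_logSobolev :
    ∃ c₀ C₀ : ℝ, 0 < c₀ ∧ 0 < C₀ ∧
      ∀ (N : ℕ), 2 ≤ N → Even N →
      ∀ (G : SimpleGraph (Fin N → Bool)) [DecidableRel G.Adj],
      (∀ x y : Fin N → Bool, G.Adj x y ↔
        ∃ i : Fin N, x i ≠ y i ∧ ∀ j : Fin N, j ≠ i → x j = y j) →
      ∀ (p : (Fin N → Bool) → (Fin N → Bool) → ℝ),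
      (∀ x y, G.Adj x y → p x y = 1 / (N : ℝ)) →
      (∀ x y, ¬ G.Adj x y → p x y = 0) →
      ∀ (ν : (Fin N → Bool) → ℝ), (∀ x, ν x = 1 / 2 ^ N) →
      ∀ (μ : ((Fin N → Bool) → Bool) → ℝ), (∀ σ, μ σ = 1 / 2 ^ 2 ^ N) →
      ∀ (c : (Fin N → Bool) → ((Fin N → Bool) → Bool) → ℝ),
      (∀ x σ, c x σ = 1 / 2) →
      ∀ (Clsπ : ℝ),
      IsLeast {C : ℝ | ∀ f : ((Fin N → Bool) → Bool) → (Fin N → Bool) → ℝ,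
        EntPi μ ν f ≤ C * Epi G p ν μ c f} Clsπ →
      c₀ * (N : ℝ) * 2 ^ N ≤ Clsπ ∧ Clsπ ≤ C₀ * (N : ℝ) * 2 ^ N := by
  refine ⟨1 / 2, 28, by norm_num, by norm_num, ?_⟩
  intro N hN _ G _ hG p hp _ ν hν μ hμ c hc Clsπ hC
  obtain rfl : ν = fun _ => 1 / 2 ^ N := funext hν
  obtain rfl : μ = fun _ => 1 / 2 ^ 2 ^ N := funext hμ
  have hE : ∀ f, Epi G p (fun _ => 1 / 2 ^ N) (fun _ => 1 / 2 ^ 2 ^ N) c f =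
      1 / 4 * ∑ σ : (Fin N → Bool) → Bool, ∑ x : Fin N → Bool,
        (1 / 2 ^ 2 ^ N * (1 / 2 ^ N)) * ((1 / (N : ℝ) * ∑ i, (f σ (flipAt x i) - f σ x) ^ 2)
          + 1 / 2 * (f (flipAt σ x) x - f σ x) ^ 2) := by
    intro f
    unfold Epi
    congr 1
    refine Finset.sum_congr rfl fun σ _ => Finset.sum_congr rfl fun x _ => ?_
    rw [nbr_sum N G hG p hp x (fun y => (f σ y - f σ x) ^ 2), hc]
  have hNp : (0 : ℝ) < N := by exact_mod_cast (by omega : 0 < N)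
  constructor
  · obtain ⟨f, P, hP, h1, h2⟩ := lower_bound N hN
    have h3 := hC.1 f
    rw [hE, h2] at h3
    have h4 := h1.trans h3
    have h5 : P * (2 ^ (N - 1) * Real.log 2) ≤ P * (Clsπ / (2 * N)) :=
      h4.trans (le_of_eq (by field_simp; norm_num))
    have h6 := le_of_mul_le_mul_left h5 hP
    rw [le_div_iff₀ (by positivity)] at h6
    have h7 : (2 : ℝ) ^ N = 2 ^ (N - 1) * 2 := by
      rw [← pow_succ]; congr 1; omega
    have h8 : (1 / 2 : ℝ) ≤ Real.log 2 := by linarith [Real.log_two_gt_d9]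
    refine le_trans ?_ h6
    rw [h7]
    have h9 : (0 : ℝ) ≤ 2 ^ (N - 1) * (2 * N) := by positivity
    nlinarith [mul_le_mul_of_nonneg_left h8 h9]
  · refine hC.2 fun f => ?_
    rw [hE]
    refine (upper_bound N hN f).trans (le_of_eq ?_)
    ring
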